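/- arXiv:1706.02916 — 2 statements merged into one kernel-verified Lean document; each statement's English description precedes it below -/
import Mathlib

section
/- Let p be a prime and let G be an abelian bi-Δ-group which is p-local and satisfies 𝔥_i G = 0 for all i ≤ k. Then for each m ≥ 0 there is a short exact sequence 0 → Z_{m+1} G ⊕ Z_{m+2} G ⊕ ⋯ ⊕ Z_{m+p} G → 𝔥_{m+p} G → 𝔥_m G → 0; that is, the composite p_{m,m+p} = p_{m+1} ∘ ⋯ ∘ p_{m+p} : 𝔥_{m+p} G → 𝔥_m G is surjective and its kernel is isomorphic as an abelian group to the direct sum Z_{m+1} G ⊕ ⋯ ⊕ Z_{m+p} G. -/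
universe u

section

variable (G : ℕ → Type u) [∀ n, AddCommGroup (G n)]
variable (d : ∀ n : ℕ, ℕ → (G (n + 1) →+ G n))
variable (δ : ∀ n : ℕ, ℕ → (G n →+ G (n + 1)))

/-- The axioms of an (abelian, additively written) bi-Δ-group: a sequence of groups `G n`
with faces `d n j : G (n+1) →+ G n` (for `j ≤ n+1`) and cofaces
`δ n i : G n →+ G (n+1)` (for `i ≤ n+1`), satisfying the simplicial-type identities. -/
structure IsBiDelta : Prop where
  face_face : ∀ n i j : ℕ, i ≤ j → j ≤ n + 1 → ∀ x : G (n + 2),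
    d n i (d (n + 1) (j + 1) x) = d n j (d (n + 1) i x)
  coface_coface : ∀ n i j : ℕ, j ≤ i → i ≤ n + 1 → ∀ x : G n,
    δ (n + 1) j (δ n i x) = δ (n + 1) (i + 1) (δ n j x)
  face_coface_lt : ∀ n i j : ℕ, j ≤ i → i ≤ n + 1 → ∀ x : G (n + 1),
    d (n + 1) j (δ (n + 1) (i + 1) x) = δ n i (d n j x)
  face_coface_eq : ∀ n i : ℕ, i ≤ n + 1 → ∀ x : G n, d n i (δ n i x) = x
  face_coface_gt : ∀ n i j : ℕ, i ≤ j → j ≤ n + 1 → ∀ x : G (n + 1),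
    d (n + 1) (j + 1) (δ (n + 1) i x) = δ n i (d n j x)

/-- The `n`-th Cohen group `𝔥_n G = {x ∈ G_n : d_0 x = d_1 x = ⋯ = d_n x}`
(with `𝔥_0 G = G_0`), as a subgroup of `G n`. -/
def cohenAll : ∀ n : ℕ, AddSubgroup (G n)
  | 0 => ⊤
  | m + 1 =>
    { carrier := { x : G (m + 1) | ∀ j, j ≤ m + 1 → d m j x = d m 0 x }
      add_mem' := fun {a b} ha hb j hj => by
        simp only [Set.mem_setOf_eq] at ha hb ⊢
        rw [map_add, map_add, ha j hj, hb j hj]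
      zero_mem' := fun j hj => by simp
      neg_mem' := fun {a} ha j hj => by
        simp only [Set.mem_setOf_eq] at ha ⊢
        rw [map_neg, map_neg, ha j hj] }

/-- The `n`-th Moore cycle group `Z_n G = ⋂_{j=0}^n ker d_j` (with `Z_0 G = G_0`),
as a subgroup of `G n`. -/
def mooreAll : ∀ n : ℕ, AddSubgroup (G n)
  | 0 => ⊤
  | m + 1 =>
    { carrier := { x : G (m + 1) | ∀ j, j ≤ m + 1 → d m j x = 0 }
      add_mem' := fun {a b} ha hb j hj => by
        simp only [Set.mem_setOf_eq] at ha hb ⊢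
        rw [map_add, ha j hj, hb j hj, add_zero]
      zero_mem' := fun j hj => by simp
      neg_mem' := fun {a} ha j hj => by
        simp only [Set.mem_setOf_eq] at ha ⊢
        rw [map_neg, ha j hj, neg_zero] }

/-- Iterated cofaces `d^{c(r-1)} d^{c(r-2)} ⋯ d^{c(0)}(x)` along a tuple `c` of coface
indices (`c 0` is applied first, at level `k`). -/
def iterCoface (k : ℕ) : ∀ r : ℕ, (Fin r → ℕ) → G k → G (k + r)
  | 0, _, x => x
  | r + 1, c, x => δ (k + r) (c (Fin.last r)) (iterCoface k r (fun i => c i.castSucc) x)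

open Classical in
/-- The James–Hopf homomorphism `H_{k,n} : G_k → G_n` (`n = k + r`): the sum, over all
strictly increasing tuples `0 ≤ i_1 < i_2 < ⋯ < i_{n-k} ≤ n`, of
`d^{i_{n-k}} d^{i_{n-k-1}} ⋯ d^{i_1}(x)`. -/
noncomputable def jamesHopf (k r : ℕ) (x : G k) : G (k + r) :=
  ∑ c ∈ Finset.univ.filter (fun c : Fin r → Fin (k + r + 1) => StrictMono c),
    iterCoface G δ k r (fun i => (c i : ℕ)) x

/-- `σ_{m+1} = H_{m,m+1} = Σ_{i=0}^{m+1} d^i : G m →+ G (m+1)` (as a function). -/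
def sigmaMap (m : ℕ) (x : G m) : G (m + 1) :=
  ∑ i ∈ Finset.range (m + 2), δ m i x

/-- The composite `σ_{s+r} ∘ σ_{s+r-1} ∘ ⋯ ∘ σ_{s+1} : G s → G (s+r)`. -/
def sigmaIter (s : ℕ) : ∀ r : ℕ, G s → G (s + r)
  | 0, x => x
  | r + 1, x => sigmaMap G δ (s + r) (sigmaIter s r x)

/-- The `r`-fold iterate of the zeroth face `d_0 : G (m+r) → G m`,
i.e. `p_{m+1} ∘ p_{m+2} ∘ ⋯ ∘ p_{m+r}` on Cohen groups. -/
def dIter (m : ℕ) : ∀ r : ℕ, G (m + r) → G m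
  | 0, x => x
  | r + 1, x => dIter m r (d (m + r) 0 x)

end

section Aux

variable {G : ℕ → Type u} [∀ n, AddCommGroup (G n)]
variable {d : ∀ n : ℕ, ℕ → (G (n + 1) →+ G n)}
variable {δ : ∀ n : ℕ, ℕ → (G n →+ G (n + 1))}

theorem aux_mem_cohen {n : ℕ} {x : G (n + 1)} :
    x ∈ cohenAll G d (n + 1) ↔ ∀ j, j ≤ n + 1 → d n j x = d n 0 x := Iff.rfl

theorem aux_mem_moore {n : ℕ} {x : G (n + 1)} :
    x ∈ mooreAll G d (n + 1) ↔ ∀ j, j ≤ n + 1 → d n j x = 0 := Iff.rfl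

theorem aux_d_mem (h : IsBiDelta G d δ) (n : ℕ) (x : G (n + 1))
    (hx : x ∈ cohenAll G d (n + 1)) : d n 0 x ∈ cohenAll G d n := by
  cases n with
  | zero => trivial
  | succ n =>
    rw [aux_mem_cohen] at hx ⊢
    intro j hj
    rw [← h.face_face n 0 j (Nat.zero_le _) hj, hx (j + 1) (by omega)]

/-- The sum of all cofaces as a homomorphism. -/
def auxSigma (δ : ∀ n : ℕ, ℕ → (G n →+ G (n + 1))) (n : ℕ) : G n →+ G (n + 1) :=
  ∑ i ∈ Finset.range (n + 2), δ n i

theorem auxSigma_apply (n : ℕ) (x : G n) :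
    auxSigma δ n x = ∑ i ∈ Finset.range (n + 2), δ n i x := by
  simp [auxSigma]

theorem aux_d_sigma (h : IsBiDelta G d δ) (n : ℕ) (x : G (n + 1))
    (hx : x ∈ cohenAll G d (n + 1)) (j : ℕ) (hj : j ≤ n + 2) :
    d (n + 1) j (auxSigma δ (n + 1) x) = x + auxSigma δ n (d n 0 x) := by
  rw [aux_mem_cohen] at hx
  obtain ⟨t, ht⟩ := Nat.exists_eq_add_of_le hj
  have e1 : n + 1 + 2 = j + (t + 1) := by omega
  have r1 : Finset.range (n + 1 + 2) = Finset.range (j + (t + 1)) := by rw [e1]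
  have r2 : Finset.range (n + 2) = Finset.range (j + t) := by rw [ht]
  rw [auxSigma_apply, auxSigma_apply, map_sum, r1, r2, Finset.sum_range_add _ j (t + 1),
    Finset.sum_range_add _ j t, Finset.sum_range_succ' _ t]
  have a1 : ∀ i ∈ Finset.range j, d (n + 1) j (δ (n + 1) i x) = δ n i (d n 0 x) := by
    intro i hi
    rw [Finset.mem_range] at hi
    obtain ⟨j', rfl⟩ : ∃ j', j = j' + 1 := ⟨j - 1, by omega⟩
    rw [h.face_coface_gt n i j' (by omega) (by omega), hx j' (by omega)]
  have a2 : ∀ i ∈ Finset.range t,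
      d (n + 1) j (δ (n + 1) (j + (i + 1)) x) = δ n (j + i) (d n 0 x) := by
    intro i hi
    rw [Finset.mem_range] at hi
    rw [← add_assoc, h.face_coface_lt n (j + i) j (by omega) (by omega), hx j (by omega)]
  rw [Finset.sum_congr rfl a1, Finset.sum_congr rfl a2, add_zero,
    h.face_coface_eq (n + 1) j (by omega)]
  abel

theorem aux_sigma_mem (h : IsBiDelta G d δ) (n : ℕ) (x : G (n + 1))
    (hx : x ∈ cohenAll G d (n + 1)) : auxSigma δ (n + 1) x ∈ cohenAll G d (n + 2) := by
  rw [aux_mem_cohen]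
  intro j hj
  rw [aux_d_sigma h n x hx j hj, aux_d_sigma h n x hx 0 (by omega)]

theorem aux_surj (h : IsBiDelta G d δ) (h0 : ∀ x : G 0, x = 0) (n : ℕ) (y : G n)
    (hy : y ∈ cohenAll G d n) : ∃ x ∈ cohenAll G d (n + 1), d n 0 x = y := by
  cases n with
  | zero => exact ⟨0, zero_mem _, by rw [h0 y, map_zero]⟩
  | succ n =>
    rw [aux_mem_cohen] at hy
    have key : ∀ t, t ≤ n + 2 → ∃ x : G (n + 2), ∀ j, j ≤ t → d (n + 1) j x = y := by
      intro t
      induction t with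
      | zero =>
        intro _
        refine ⟨δ (n + 1) 0 y, fun j hj => ?_⟩
        obtain rfl : j = 0 := by omega
        exact h.face_coface_eq (n + 1) 0 (by omega) y
      | succ t ih =>
        intro ht
        obtain ⟨x, hx⟩ := ih (by omega)
        refine ⟨x + δ (n + 1) (t + 1) (y - d (n + 1) (t + 1) x), fun j hj => ?_⟩
        rw [map_add]
        rcases Nat.lt_or_ge t j with hlt | hle
        · obtain rfl : j = t + 1 := by omega
          rw [h.face_coface_eq (n + 1) (t + 1) (by omega)]
          abel
        · rw [h.face_coface_lt n t j hle (by omega), map_sub,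
            h.face_face n j t hle (by omega), hx j hle, hy j (by omega), hy t (by omega)]
          simp
    obtain ⟨x, hx⟩ := key (n + 2) le_rfl
    refine ⟨x, ?_, hx 0 (by omega)⟩
    rw [aux_mem_cohen]
    intro j hj
    rw [hx j hj, hx 0 (by omega)]

theorem aux_surj_iter (h : IsBiDelta G d δ) (h0 : ∀ x : G 0, x = 0) (m r : ℕ) :
    ∀ y ∈ cohenAll G d m, ∃ x ∈ cohenAll G d (m + r), dIter G d m r x = y := by
  induction r with
  | zero => exact fun y hy => ⟨y, hy, rfl⟩
  | succ r ih =>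
    intro y hy
    obtain ⟨x, hx, rfl⟩ := ih y hy
    obtain ⟨z, hz, rfl⟩ := aux_surj h h0 (m + r) x hx
    exact ⟨z, hz, rfl⟩

theorem aux_dIter_zero (m r : ℕ) : dIter G d m r 0 = 0 := by
  induction r with
  | zero => rfl
  | succ r ih =>
    show dIter G d m r (d (m + r) 0 0) = 0
    rw [map_zero, ih]

theorem aux_bij (p : ℕ)
    (hloc : ∀ q : ℕ, q.Prime → q ≠ p → ∀ n, Function.Bijective fun x : G n => q • x)
    (n a : ℕ) : 0 < a → a < p → Function.Bijective fun x : G n => a • x := by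
  induction a using induction_on_primes with
  | zero => intro h; omega
  | one => intro _ _; simp only [one_smul]; exact Function.bijective_id
  | prime_mul q a hq ih =>
    intro hpos hlt
    have ha : 0 < a := Nat.pos_of_mul_pos_left hpos
    have h1 : a ≤ q * a := Nat.le_mul_of_pos_left a hq.pos
    have h2 : q ≤ q * a := Nat.le_mul_of_pos_right q ha
    have := (hloc q hq (by omega) n).comp (ih ha (by omega))
    have e : (fun x : G n => (q * a) • x) = (fun x => q • x) ∘ fun x => a • x := by
      funext x; simp [mul_smul]
    rw [e]; exact this

theorem aux_inv {A : Type*} [AddCommGroup A] (a : ℕ)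
    (ha : Function.Bijective fun x : A => a • x) : ∃ c : A →+ A, ∀ x, a • c x = x := by
  let e : A ≃+ A := AddEquiv.ofBijective (nsmulAddMonoidHom a : A →+ A) ha
  exact ⟨e.symm.toAddMonoidHom, fun x => e.apply_symm_apply x⟩

theorem aux_main (h : IsBiDelta G d δ) (m r : ℕ)
    (hinv : ∀ a, 0 < a → a ≤ r → ∀ n, Function.Bijective fun x : G n => a • x) :
    ∃ s : ∀ i : Fin (r + 1), ↥(mooreAll G d (m + (i : ℕ) + 1)) →+ G (m + r + 1),
      (∀ i z, s i z ∈ cohenAll G d (m + r + 1)) ∧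
      (∀ i z, auxSigma δ (m + r) (d (m + r) 0 (s i z)) = (r - (i : ℕ)) • s i z) ∧
      (∀ v : (∀ i : Fin (r + 1), ↥(mooreAll G d (m + (i : ℕ) + 1))),
        ∑ i, s i (v i) = 0 → v = 0) ∧
      (∀ v : (∀ i : Fin (r + 1), ↥(mooreAll G d (m + (i : ℕ) + 1))),
        dIter G d m (r + 1) (∑ i, s i (v i)) = 0) ∧
      (∀ x ∈ cohenAll G d (m + r + 1), dIter G d m (r + 1) x = 0 →
        ∃ v : (∀ i : Fin (r + 1), ↥(mooreAll G d (m + (i : ℕ) + 1))), ∑ i, s i (v i) = x) := by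
  induction r with
  | zero =>
    refine ⟨fun i => Fin.cases (motive := fun i : Fin 1 =>
      ↥(mooreAll G d (m + (i : ℕ) + 1)) →+ G (m + 0 + 1)) (mooreAll G d (m + 0 + 1)).subtype
      (fun i => i.elim0) i, ?_, ?_, ?_, ?_, ?_⟩
    · intro i
      obtain rfl : i = 0 := Fin.ext (by omega)
      intro z j hj
      exact (z.2 j hj).trans (z.2 0 (Nat.zero_le _)).symm
    · intro i
      obtain rfl : i = 0 := Fin.ext (by omega)
      intro z
      have hz : d (m + 0) 0 (z : G (m + 0 + 1)) = 0 := z.2 0 (Nat.zero_le _)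
      simp only [Fin.cases_zero]
      change auxSigma δ (m + 0) (d (m + 0) 0 (z : G (m + 0 + 1))) = _
      rw [hz, map_zero]
      simp
    · intro v hv
      rw [Fin.sum_univ_one] at hv
      funext i
      obtain rfl : i = 0 := Fin.ext (by omega)
      exact Subtype.ext hv
    · intro v
      rw [Fin.sum_univ_one]
      exact (v 0).2 0 (Nat.zero_le _)
    · intro x hx hx0
      refine ⟨fun i => Fin.cases (motive := fun i : Fin 1 =>
        ↥(mooreAll G d (m + (i : ℕ) + 1))) ⟨x, fun j hj => (hx j hj).trans hx0⟩
        (fun i => i.elim0) i, ?_⟩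
      rw [Fin.sum_univ_one]
      rfl
  | succ r ih =>
    obtain ⟨s, hs1, hs2, hs3, hs4, hs5⟩ := ih (fun a h1 h2 => hinv a h1 (by omega))
    have hc : ∀ i : Fin (r + 1), ∃ c : G (m + r + 2) →+ G (m + r + 2),
        ∀ x, (r + 1 - (i : ℕ)) • c x = x := fun i =>
      aux_inv _ (hinv _ (by omega) (by omega) _)
    choose c hc using hc
    have hinj : ∀ (i : Fin (r + 1)) (n : ℕ) (x y : G n),
        (r + 1 - (i : ℕ)) • x = (r + 1 - (i : ℕ)) • y → x = y := fun i n x y hxy =>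
      (hinv (r + 1 - (i : ℕ)) (by omega) (by omega) n).1 hxy
    let s' : ∀ i : Fin (r + 2), ↥(mooreAll G d (m + (i : ℕ) + 1)) →+ G (m + r + 2) :=
      fun i => Fin.lastCases (motive := fun i : Fin (r + 2) =>
        ↥(mooreAll G d (m + (i : ℕ) + 1)) →+ G (m + r + 2))
        (mooreAll G d (m + (r + 1) + 1)).subtype
        (fun i => (c i).comp ((auxSigma δ (m + r + 1)).comp (s i))) i
    have sl : ∀ z : ↥(mooreAll G d (m + (r + 1) + 1)),
        s' (Fin.last (r + 1)) z = (z : G (m + (r + 1) + 1)) := by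
      intro z
      simp only [s', Fin.lastCases_last]
      rfl
    have sc : ∀ (i : Fin (r + 1)) (z : ↥(mooreAll G d (m + (i : ℕ) + 1))),
        s' i.castSucc z = c i (auxSigma δ (m + r + 1) (s i z)) := by
      intro i z
      simp only [s', Fin.lastCases_castSucc]
      rfl
    have scm : ∀ (i : Fin (r + 1)) (z : ↥(mooreAll G d (m + (i : ℕ) + 1))),
        (r + 1 - (i : ℕ)) • s' i.castSucc z = auxSigma δ (m + r + 1) (s i z) := by
      intro i z
      rw [sc, hc]
    have dj : ∀ (i : Fin (r + 1)) (z : ↥(mooreAll G d (m + (i : ℕ) + 1))) (j : ℕ),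
        j ≤ m + r + 2 → d (m + r + 1) j (s' i.castSucc z) = s i z := by
      intro i z j hj
      apply hinj i
      rw [← map_nsmul, scm, aux_d_sigma h (m + r) _ (hs1 i z) j hj, hs2]
      have : r + 1 - (i : ℕ) = (r - (i : ℕ)) + 1 := by omega
      rw [this, succ_nsmul, add_comm (s i z)]
    have dl : ∀ (z : ↥(mooreAll G d (m + (r + 1) + 1))) (j : ℕ),
        j ≤ m + r + 2 → d (m + r + 1) j (s' (Fin.last (r + 1)) z) = 0 := by
      intro z j hj
      rw [sl]
      exact z.2 j hj
    have dsum : ∀ (v : (∀ i : Fin (r + 2), ↥(mooreAll G d (m + (i : ℕ) + 1)))) (j : ℕ),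
        j ≤ m + r + 2 →
        d (m + r + 1) j (∑ i, s' i (v i)) = ∑ i : Fin (r + 1), s i (v i.castSucc) := by
      intro v j hj
      rw [Fin.sum_univ_castSucc, map_add, map_sum]
      have := dl (v (Fin.last (r + 1))) j hj
      rw [this, add_zero]
      exact Finset.sum_congr rfl fun i _ => dj i (v i.castSucc) j hj
    refine ⟨s', ?_, ?_, ?_, ?_, ?_⟩
    · intro i
      induction i using Fin.lastCases with
      | last =>
        intro z j hj
        exact (dl z j hj).trans (dl z 0 (by omega)).symm
      | cast i =>
        intro z j hj
        exact (dj i z j hj).trans (dj i z 0 (by omega)).symm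
    · intro i
      induction i using Fin.lastCases with
      | last =>
        intro z
        have := dl z 0 (by omega)
        change auxSigma δ (m + r + 1) (d (m + r + 1) 0 (s' (Fin.last (r + 1)) z)) = _
        rw [this, map_zero]
        simp
      | cast i =>
        intro z
        change auxSigma δ (m + r + 1) (d (m + r + 1) 0 (s' i.castSucc z)) = _
        have := dj i z 0 (by omega)
        rw [this]
        exact (scm i z).symm
    · intro v hv
      have h1 := dsum v 0 (by omega)
      have hv' : ∑ i, s' i (v i) = 0 := hv
      rw [hv', map_zero] at h1
      have h2 := hs3 (fun i => v i.castSucc) h1.symm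
      have h3 : ∀ i : Fin (r + 1), v i.castSucc = 0 := fun i => congrFun h2 i
      have h4 : v (Fin.last (r + 1)) = 0 := by
        rw [Fin.sum_univ_castSucc, Finset.sum_eq_zero, zero_add] at hv'
        · have := sl (v (Fin.last (r + 1)))
          exact Subtype.ext (this.symm.trans hv')
        · intro i _
          rw [h3 i, map_zero]
      funext i
      induction i using Fin.lastCases with
      | last => exact h4
      | cast i => exact h3 i
    · intro v
      change dIter G d m (r + 1) (d (m + r + 1) 0 (∑ i, s' i (v i))) = 0
      rw [dsum v 0 (by omega)]
      exact hs4 (fun i => v i.castSucc)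
    · intro x hx hx0
      obtain ⟨v, hv⟩ := hs5 (d (m + r + 1) 0 x) (aux_d_mem h (m + r + 1) x hx) hx0
      let w : ∀ z : ↥(mooreAll G d (m + (r + 1) + 1)),
          ∀ i : Fin (r + 2), ↥(mooreAll G d (m + (i : ℕ) + 1)) := fun z i =>
        Fin.lastCases (motive := fun i : Fin (r + 2) => ↥(mooreAll G d (m + (i : ℕ) + 1)))
          z v i
      have wl : ∀ z, w z (Fin.last (r + 1)) = z := fun z => by
        simp only [w, Fin.lastCases_last]
      have wc : ∀ z (i : Fin (r + 1)), w z i.castSucc = v i := fun z i => by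
        simp only [w, Fin.lastCases_castSucc]
      have hz : x - ∑ i : Fin (r + 1), s' i.castSucc (v i) ∈
          mooreAll G d (m + (r + 1) + 1) := by
        intro j hj
        change d (m + r + 1) j _ = 0
        rw [map_sub, map_sum, Finset.sum_congr rfl fun i _ => dj i (v i) j hj, hv]
        exact sub_eq_zero.2 (hx j hj)
      refine ⟨w ⟨_, hz⟩, ?_⟩
      change ∑ i, s' i (w ⟨_, hz⟩ i) = x
      rw [Fin.sum_univ_castSucc]
      have e1 := sl (w ⟨_, hz⟩ (Fin.last (r + 1)))
      rw [wl] at e1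
      rw [wl, e1, Finset.sum_congr rfl fun i _ => by rw [wc]]
      exact add_sub_cancel _ _

end Aux

/-- Let `p` be a prime and `G` an abelian bi-Δ-group which is `p`-local
and satisfies `𝔥_i G = 0` for all `i ≤ k`. Then for each `m ≥ 0` there is a short exact
sequence `0 → Z_{m+1} G ⊕ ⋯ ⊕ Z_{m+p} G → 𝔥_{m+p} G → 𝔥_m G → 0`: the composite
`p_{m,m+p} = p_{m+1} ∘ ⋯ ∘ p_{m+p}` (the `p`-fold iterate of `d_0`) maps `𝔥_{m+p} G`
onto `𝔥_m G`, and its kernel (inside `𝔥_{m+p} G`) is isomorphic, via an injective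
homomorphism `φ`, to the direct sum `⊕_{i=1}^{p} Z_{m+i} G`. -/
theorem stmt14 (G : ℕ → Type u) [∀ n, AddCommGroup (G n)]
    (d : ∀ n : ℕ, ℕ → (G (n + 1) →+ G n)) (δ : ∀ n : ℕ, ℕ → (G n →+ G (n + 1)))
    (h : IsBiDelta G d δ) (p k : ℕ) (hp : p.Prime)
    (hloc : ∀ q : ℕ, q.Prime → q ≠ p → ∀ n, Function.Bijective fun x : G n => q • x)
    (hvanish : ∀ i ≤ k, ∀ x ∈ cohenAll G d i, x = 0)
    (m : ℕ) :
    (∀ y ∈ cohenAll G d m, ∃ x ∈ cohenAll G d (m + p), dIter G d m p x = y) ∧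
    ∃ φ : (∀ i : Fin p, ↥(mooreAll G d (m + (i : ℕ) + 1))) →+ G (m + p),
      Function.Injective φ ∧
      (∀ v, φ v ∈ cohenAll G d (m + p)) ∧
      (∀ v, dIter G d m p (φ v) = 0) ∧
      ∀ x ∈ cohenAll G d (m + p), dIter G d m p x = 0 → ∃ v, φ v = x := by
  have h0 : ∀ x : G 0, x = 0 := fun x => hvanish 0 (Nat.zero_le _) x trivial
  refine ⟨aux_surj_iter h h0 m p, ?_⟩
  obtain ⟨r, rfl⟩ : ∃ r, p = r + 1 := ⟨p - 1, by have := hp.pos; omega⟩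
  obtain ⟨s, hs1, -, hs3, hs4, hs5⟩ := aux_main h m r
    (fun a h1 h2 n => aux_bij (r + 1) hloc n a h1 (by omega))
  let φ : (∀ i : Fin (r + 1), ↥(mooreAll G d (m + (i : ℕ) + 1))) →+ G (m + (r + 1)) :=
    ∑ i, (s i).comp (Pi.evalAddMonoidHom _ i)
  have hφ : ∀ v, φ v = ∑ i, s i (v i) := by
    intro v
    simp only [φ, AddMonoidHom.finsetSum_apply]
    rfl
  refine ⟨φ, ?_, ?_, ?_, ?_⟩
  · rw [injective_iff_map_eq_zero]
    intro v hv
    exact hs3 v ((hφ v).symm.trans hv)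
  · intro v
    rw [hφ]
    exact AddSubgroup.sum_mem (cohenAll G d (m + r + 1)) fun i _ => hs1 i (v i)
  · intro v
    rw [hφ]
    exact hs4 v
  · intro x hx hx0
    obtain ⟨v, hv⟩ := hs5 x hx hx0
    exact ⟨v, (hφ v).trans hv⟩
end

section
/- Let G be an abelian bi-Δ-group, n ≥ m ≥ 1, and suppose given group homomorphisms π : 𝔥_m G → Z_m G with π restricting to the identity on Z_m G, and i : 𝔥_n G → 𝔥G with p_{n,∞} ∘ i = id (a section of the limit projection). Then the endomorphism e_{m,n} = i ∘ H_{m,n} ∘ i_m ∘ π ∘ p_{m,n} ∘ p_{n,∞} of the total Cohen group 𝔥G is idempotent. -/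
universe u

/-- The total Cohen group `𝔥G`: the inverse limit of the tower `(𝔥_n G, p_n)`, realized
as compatible sequences `(x_n)` with `x_n ∈ 𝔥_n G` and `d_0 (x_{n+1}) = x_n`. -/
def TotalCohen (G : ℕ → Type u) [∀ n, AddCommGroup (G n)]
    (d : ∀ n : ℕ, ℕ → (G (n + 1) →+ G n)) : Type u :=
  { x : ∀ n, G n // (∀ n, x n ∈ cohenAll G d n) ∧ ∀ n, d n 0 (x (n + 1)) = x n }

theorem aux_grow {r N : ℕ} (c : Fin r → Fin N) (hc : StrictMono c) (i : Fin r) :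
    ∀ j : ℕ, ∀ hj : i.1 + j < r, (c i : ℕ) + j ≤ c ⟨i.1 + j, hj⟩
  | 0, _ => le_rfl
  | j + 1, hj => by
    have h1 := aux_grow c hc i j (by omega)
    have h2 : c ⟨i.1 + j, by omega⟩ < c ⟨i.1 + (j + 1), hj⟩ :=
      hc (by rw [Fin.lt_def]; simp only; omega)
    rw [Fin.lt_def] at h2
    omega

theorem aux_bound {r N : ℕ} (c : Fin r → Fin N) (hc : StrictMono c) (i : Fin r) :
    (c i : ℕ) + r ≤ N + i := by
  have hi := i.2
  have h1 := aux_grow c hc i (r - 1 - i) (by omega)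
  have h2 := (c ⟨i.1 + (r - 1 - i), by omega⟩).2
  omega

theorem aux_zero (G : ℕ → Type u) [∀ n, AddCommGroup (G n)]
    (d : ∀ n : ℕ, ℕ → (G (n + 1) →+ G n)) (δ : ∀ n : ℕ, ℕ → (G n →+ G (n + 1)))
    (h : IsBiDelta G d δ) (a : ℕ) (z : G (a + 1)) (hz : d a 0 z = 0) :
    ∀ (r : ℕ) (c : Fin (r + 1) → ℕ),
      (∀ i, 1 ≤ c i ∧ c i ≤ a + 1 + i + 1) →
      d (a + 1 + r) 0 (iterCoface G δ (a + 1) (r + 1) c z) = 0 := by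
  intro r
  induction r with
  | zero =>
    intro c hc
    obtain ⟨h1, h2⟩ := hc (Fin.last 0)
    obtain ⟨e, he⟩ : ∃ e, c (Fin.last 0) = e + 1 := ⟨c (Fin.last 0) - 1, by omega⟩
    simp only [Fin.val_last] at h2
    change d (a + 1) 0 (δ (a + 1) (c (Fin.last 0)) z) = 0
    rw [he, h.face_coface_lt a e 0 (Nat.zero_le _) (by omega), hz, map_zero]
  | succ r ih =>
    intro c hc
    obtain ⟨h1, h2⟩ := hc (Fin.last (r + 1))
    obtain ⟨e, he⟩ : ∃ e, c (Fin.last (r + 1)) = e + 1 := ⟨c (Fin.last (r + 1)) - 1, by omega⟩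
    simp only [Fin.val_last] at h2
    have hh := h.face_coface_lt (a + 1 + r) e 0 (Nat.zero_le _) (by omega)
      (iterCoface G δ (a + 1) (r + 1) (fun i => c i.castSucc) z)
    rw [ih (fun i => c i.castSucc) (fun i => hc i.castSucc), map_zero, ← he] at hh
    exact hh

theorem aux_shift (G : ℕ → Type u) [∀ n, AddCommGroup (G n)]
    (d : ∀ n : ℕ, ℕ → (G (n + 1) →+ G n)) (δ : ∀ n : ℕ, ℕ → (G n →+ G (n + 1)))
    (h : IsBiDelta G d δ) (k : ℕ) (z : G k) :
    ∀ (r : ℕ) (c : Fin r → ℕ), (∀ i, c i ≤ k + i + 1) →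
      d (k + r) 0 (iterCoface G δ k (r + 1)
        (Fin.cons (α := fun _ => ℕ) 0 (fun i => c i + 1)) z) = iterCoface G δ k r c z := by
  intro r
  induction r with
  | zero =>
    intro c hc
    exact h.face_coface_eq k 0 (Nat.zero_le _) z
  | succ r ih =>
    intro c hc
    have h2 := hc (Fin.last r)
    simp only [Fin.val_last] at h2
    have hh := h.face_coface_lt (k + r) (c (Fin.last r)) 0 (Nat.zero_le _) (by omega)
      (iterCoface G δ k (r + 1)
        (Fin.cons (α := fun _ => ℕ) 0 (fun i : Fin r => c i.castSucc + 1)) z)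
    rw [ih (fun i => c i.castSucc) (fun i => hc i.castSucc)] at hh
    have e1 : (fun i : Fin (r + 1) => (Fin.cons (α := fun _ => ℕ) 0
        (fun i : Fin (r + 1) => c i + 1) : Fin (r + 2) → ℕ) i.castSucc)
        = Fin.cons (α := fun _ => ℕ) 0 (fun i : Fin r => c i.castSucc + 1) := by
      funext i
      refine Fin.cases ?_ (fun j => ?_) i
      · rfl
      · rfl
    rw [← e1] at hh
    exact hh

theorem aux_face (G : ℕ → Type u) [∀ n, AddCommGroup (G n)]
    (d : ∀ n : ℕ, ℕ → (G (n + 1) →+ G n)) (δ : ∀ n : ℕ, ℕ → (G n →+ G (n + 1)))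
    (h : IsBiDelta G d δ) (a : ℕ) (z : G (a + 1)) (hz : d a 0 z = 0) (r : ℕ) :
    d (a + 1 + r) 0 (jamesHopf G δ (a + 1) (r + 1) z) = jamesHopf G δ (a + 1) r z := by
  classical
  unfold jamesHopf
  refine (map_sum (d (a + 1 + r) 0) _ _).trans ?_
  symm
  refine Finset.sum_of_injOn
    (fun c : Fin r → Fin (a + 1 + r + 1) =>
      (Fin.cons (α := fun _ => Fin (a + 1 + (r + 1) + 1)) 0 (fun i => (c i).succ) :
        Fin (r + 1) → Fin (a + 1 + (r + 1) + 1))) ?_ ?_ ?_ ?_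
  · intro c _ c' _ hcc
    funext i
    have := congrFun hcc i.succ
    simpa using this
  · intro c hc
    simp only [Finset.coe_filter, Finset.mem_univ, true_and, Set.mem_setOf_eq] at hc ⊢
    intro i j
    refine Fin.cases ?_ (fun i => ?_) i <;> refine Fin.cases ?_ (fun j => ?_) j
    · intro hij
      exact absurd hij (lt_irrefl _)
    · intro _
      exact Fin.succ_pos (c j)
    · intro hij
      exact absurd hij (Fin.not_lt_zero _)
    · intro hij
      exact Fin.succ_lt_succ_iff.2 (hc (Fin.succ_lt_succ_iff.1 hij))
  · intro c hc hni
    simp only [Finset.mem_filter, Finset.mem_univ, true_and] at hc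
    have hpos : ∀ i : Fin r, 0 < c i.succ := fun i =>
      lt_of_le_of_lt (Fin.zero_le _) (hc (Fin.succ_pos i))
    have h0 : c 0 ≠ 0 := by
      intro h0
      apply hni
      refine ⟨fun i => (c i.succ).pred (hpos i).ne', ?_, ?_⟩
      · simp only [Finset.coe_filter, Finset.mem_univ, true_and, Set.mem_setOf_eq]
        intro i j hij
        exact Fin.pred_lt_pred_iff.2 (hc (Fin.succ_lt_succ_iff.2 hij))
      · funext i
        refine Fin.cases ?_ (fun i => ?_) i
        · exact h0.symm
        · exact Fin.succ_pred (c i.succ) (hpos i).ne'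
    apply aux_zero G d δ h a z hz r
    intro i
    constructor
    · have h1 : c 0 ≤ c i := hc.monotone (Fin.zero_le _)
      have h2 : 0 < (c 0 : ℕ) := Nat.pos_of_ne_zero (fun h => h0 (Fin.ext h))
      rw [Fin.le_def] at h1
      omega
    · have := aux_bound c hc i
      omega
  · intro c hc
    simp only [Finset.mem_filter, Finset.mem_univ, true_and] at hc
    rw [← aux_shift G d δ h (a + 1) z r (fun i => (c i : ℕ))]
    · congr 2
      funext i
      refine Fin.cases ?_ (fun i => ?_) i
      · rfl
      · rfl
    · intro i
      have := aux_bound c hc i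
      omega

theorem aux_dIter (G : ℕ → Type u) [∀ n, AddCommGroup (G n)]
    (d : ∀ n : ℕ, ℕ → (G (n + 1) →+ G n)) (δ : ∀ n : ℕ, ℕ → (G n →+ G (n + 1)))
    (h : IsBiDelta G d δ) (a : ℕ) (z : G (a + 1)) (hz : d a 0 z = 0) (r : ℕ) :
    dIter G d (a + 1) r (jamesHopf G δ (a + 1) r z) = z := by
  induction r with
  | zero =>
    have hs : ∀ c : Fin 0 → Fin (a + 1 + 0 + 1), StrictMono c := fun c i => i.elim0
    simp [jamesHopf, dIter, iterCoface, hs]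
  | succ r ih =>
    change dIter G d (a + 1) r (d (a + 1 + r) 0 (jamesHopf G δ (a + 1) (r + 1) z)) = z
    rw [aux_face G d δ h a z hz r, ih]

/-- Let `G` be an abelian bi-Δ-group, `n ≥ m ≥ 1` (here `m = a + 1`,
`n = m + r`), `π : 𝔥_m G → Z_m G` a homomorphism restricting to the identity on `Z_m G`,
and `i : 𝔥_n G → 𝔥G` an additive section of the limit projection `p_{n,∞}`. Then the
endomorphism `e_{m,n} = i ∘ H_{m,n} ∘ i_m ∘ π ∘ p_{m,n} ∘ p_{n,∞}` of the total Cohen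
group `𝔥G` is idempotent. (`E` is that endomorphism, specified by `hE`; the membership
facts `hmem1`, `hmem2` are consequences of the bi-Δ axioms, taken as arguments.) -/
theorem stmt17 (G : ℕ → Type u) [∀ n, AddCommGroup (G n)]
    (d : ∀ n : ℕ, ℕ → (G (n + 1) →+ G n)) (δ : ∀ n : ℕ, ℕ → (G n →+ G (n + 1)))
    (h : IsBiDelta G d δ) (a r : ℕ)
    (π : ↥(cohenAll G d (a + 1)) →+ ↥(mooreAll G d (a + 1)))
    (hπ : ∀ x : ↥(cohenAll G d (a + 1)), (x : G (a + 1)) ∈ mooreAll G d (a + 1) →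
      ((π x : ↥(mooreAll G d (a + 1))) : G (a + 1)) = (x : G (a + 1)))
    (i : ↥(cohenAll G d (a + 1 + r)) → TotalCohen G d)
    (hiAdd : ∀ u v, (i (u + v)).1 = fun n => (i u).1 n + (i v).1 n)
    (hiSec : ∀ u, (i u).1 (a + 1 + r) = (u : G (a + 1 + r)))
    (hmem1 : ∀ x : TotalCohen G d,
      dIter G d (a + 1) r (x.1 (a + 1 + r)) ∈ cohenAll G d (a + 1))
    (hmem2 : ∀ z : ↥(mooreAll G d (a + 1)),
      jamesHopf G δ (a + 1) r (z : G (a + 1)) ∈ cohenAll G d (a + 1 + r))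
    (E : TotalCohen G d → TotalCohen G d)
    (hE : ∀ x : TotalCohen G d,
      E x = i ⟨jamesHopf G δ (a + 1) r
          ((π ⟨dIter G d (a + 1) r (x.1 (a + 1 + r)), hmem1 x⟩ :
              ↥(mooreAll G d (a + 1))) : G (a + 1)),
        hmem2 _⟩) :
    ∀ x : TotalCohen G d, E (E x) = E x := by
  intro x
  have key : ∀ (w : ↥(cohenAll G d (a + 1 + r))) (z : ↥(mooreAll G d (a + 1))),
      (w : G (a + 1 + r)) = jamesHopf G δ (a + 1) r (z : G (a + 1)) →
      π ⟨dIter G d (a + 1) r ((i w).1 (a + 1 + r)), hmem1 (i w)⟩ = z := by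
    intro w z hw
    have e : dIter G d (a + 1) r ((i w).1 (a + 1 + r)) = (z : G (a + 1)) := by
      rw [hiSec, hw]
      exact aux_dIter G d δ h a z (z.2 0 (Nat.zero_le _)) r
    apply Subtype.ext
    rw [hπ]
    · exact e
    · change dIter G d (a + 1) r ((i w).1 (a + 1 + r)) ∈ _
      rw [e]
      exact z.2
  rw [hE (E x)]
  have h2 := hE x
  generalize π ⟨dIter G d (a + 1) r (x.1 (a + 1 + r)), hmem1 x⟩ = z at h2
  rw [h2]
  congr 1
  apply Subtype.ext
  simp only
  rw [key _ z rfl]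
end
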